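/- Let ℳ₁ and ℳ₂ be nonempty compact metric spaces. For every multikernel (P_n)_{n≥1} from ℳ₁ to ℳ₂ there exists a single-valued multikernel (ν_n)_{n≥1} from ℳ₁ to 𝒫(ℳ₂) such that for every n, all x₁,…,xₙ ∈ ℳ₁ and every continuous function f : ℳ₂ⁿ → ℝ, ∫_{ℳ₂ⁿ} f dP_n(x₁,…,xₙ) = ∫_{𝒫(ℳ₂)ⁿ} (∫_{ℳ₂ⁿ} f d(μ₁ ⊗ … ⊗ μₙ)) dν_n(x₁,…,xₙ)(μ₁,…,μₙ). -/

import Mathlib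

open MeasureTheory

/-- The Borel σ-algebra on the space of probability measures on a topological space,
with its topology of weak convergence. -/
noncomputable instance probabilityMeasureMeasurableSpace
    {M : Type} [TopologicalSpace M] [MeasurableSpace M] [OpensMeasurableSpace M] :
    MeasurableSpace (ProbabilityMeasure M) := borel _

open Filter Topology

namespace MultikernelDeFinetti

/-- A form of the Stone–Weierstrass theorem: a linear and closed property of continuous functions
that holds on a multiplicative set separating points holds for all continuous functions. -/
theorem continuousMap_induction {X : Type*} [TopologicalSpace X] [CompactSpace X]
    (S : Submonoid C(X, ℝ)) (hS : ∀ x y : X, x ≠ y → ∃ f ∈ S, f x ≠ f y)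
    {p : C(X, ℝ) → Prop} (hclosed : IsClosed {f | p f})
    (hadd : ∀ f g, p f → p g → p (f + g)) (hsmul : ∀ (c : ℝ) f, p f → p (c • f))
    (hmem : ∀ f ∈ S, p f) (f : C(X, ℝ)) : p f := by
  have hsep : (Algebra.adjoin ℝ (S : Set C(X, ℝ))).SeparatesPoints := by
    intro x y hxy
    obtain ⟨f, hf, hne⟩ := hS x y hxy
    exact ⟨f, ⟨f, Algebra.subset_adjoin hf, rfl⟩, hne⟩
  have hf := ContinuousMap.continuousMap_mem_subalgebra_closure_of_separatesPoints _ hsep f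
  refine closure_minimal (t := {f | p f}) ?_ hclosed hf
  intro g hg
  have hg' : g ∈ Submodule.span ℝ (S : Set C(X, ℝ)) := by
    have := Algebra.adjoin_eq_span ℝ (S : Set C(X, ℝ))
    rw [Submonoid.closure_eq] at this
    rw [← this]
    exact hg
  change p g
  clear hg
  induction hg' using Submodule.span_induction with
  | mem x h => exact hmem x h
  | zero => simpa using hsmul 0 1 (hmem 1 S.one_mem)
  | add x y _ _ hx hy => exact hadd x y hx hy
  | smul a x _ hx => exact hsmul a x hx

section integral

variable {X : Type*} [TopologicalSpace X] [CompactSpace X] [MeasurableSpace X]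
  [OpensMeasurableSpace X]

theorem integrable_continuousMap (μ : Measure X) [IsFiniteMeasure μ] (f : C(X, ℝ)) :
    Integrable f μ :=
  f.continuous.integrable_of_hasCompactSupport (HasCompactSupport.of_compactSpace f)

theorem abs_integral_sub_le (μ : Measure X) [IsProbabilityMeasure μ] (f g : C(X, ℝ)) :
    |∫ x, f x ∂μ - ∫ x, g x ∂μ| ≤ ‖f - g‖ := by
  rw [← integral_sub (integrable_continuousMap μ f) (integrable_continuousMap μ g)]
  have := norm_integral_le_of_norm_le_const (μ := μ) (f := fun x => f x - g x)
    (Eventually.of_forall fun x => (f - g).norm_coe_le_norm x)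
  simpa using this

theorem continuous_integral_left (μ : Measure X) [IsProbabilityMeasure μ] :
    Continuous fun f : C(X, ℝ) => ∫ x, f x ∂μ :=
  (LipschitzWith.of_dist_le_mul (K := 1) fun f g => by
    simpa [Real.dist_eq, dist_eq_norm] using abs_integral_sub_le μ f g).continuous

end integral

variable {M : Type} [MetricSpace M] [CompactSpace M] [MeasurableSpace M] [BorelSpace M]

instance : BorelSpace (ProbabilityMeasure M) := ⟨rfl⟩

instance : SecondCountableTopology (ProbabilityMeasure M) := by
  let := TopologicalSpace.metrizableSpaceMetric (ProbabilityMeasure M)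
  infer_instance

/-- The function `μ ↦ ∏ j, ∫ f j dμ (i j)` on tuples of probability measures. -/
noncomputable def monomial {n N : ℕ} (i : Fin N → Fin n) (f : Fin N → C(M, ℝ)) :
    C(Fin n → ProbabilityMeasure M, ℝ) where
  toFun μs := ∏ j, ∫ y, f j y ∂(μs (i j) : Measure M)
  continuous_toFun := continuous_finsetProd _ fun j _ =>
    (ProbabilityMeasure.continuous_integral_continuousMap (f j)).comp (continuous_apply (i j))

/-- The function `y ↦ ∏ j, f j (y j)` on tuples of points. -/
def tensor {N : ℕ} (f : Fin N → C(M, ℝ)) : C(Fin N → M, ℝ) where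
  toFun y := ∏ j, f j (y j)
  continuous_toFun := by fun_prop

/-- The monomials form a multiplicative set. -/
noncomputable def monomials (M : Type) [MetricSpace M] [CompactSpace M] [MeasurableSpace M]
    [BorelSpace M] (n : ℕ) : Submonoid C(Fin n → ProbabilityMeasure M, ℝ) where
  carrier := {F | ∃ (N : ℕ) (i : Fin N → Fin n) (f : Fin N → C(M, ℝ)), F = monomial i f}
  one_mem' := ⟨0, Fin.elim0, Fin.elim0, by ext; simp [monomial]⟩
  mul_mem' := by
    rintro _ _ ⟨N, i, f, rfl⟩ ⟨N', i', f', rfl⟩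
    refine ⟨N + N', Fin.append i i', Fin.append f f', ?_⟩
    ext μs
    simp [monomial, Fin.prod_univ_add]

/-- The products of functions of one variable form a multiplicative set. -/
def tensors (M : Type) [MetricSpace M] (n : ℕ) : Submonoid C(Fin n → M, ℝ) where
  carrier := {F | ∃ f : Fin n → C(M, ℝ), F = tensor f}
  one_mem' := ⟨1, by ext; simp [tensor]⟩
  mul_mem' := by
    rintro _ _ ⟨f, rfl⟩ ⟨g, rfl⟩
    exact ⟨f * g, by ext; simp [tensor, Finset.prod_mul_distrib]⟩

omit [CompactSpace M] in
theorem probabilityMeasure_ext {μ ν : ProbabilityMeasure M}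
    (h : ∀ f : C(M, ℝ), ∫ y, f y ∂(μ : Measure M) = ∫ y, f y ∂(ν : Measure M)) : μ = ν :=
  ProbabilityMeasure.toMeasure_injective
    (ext_of_forall_integral_eq_of_IsFiniteMeasure fun f => h f.toContinuousMap)

theorem monomials_separate (n : ℕ) (μs νs : Fin n → ProbabilityMeasure M) (h : μs ≠ νs) :
    ∃ F ∈ monomials M n, F μs ≠ F νs := by
  obtain ⟨k, hk⟩ := Function.ne_iff.1 h
  by_contra! hF
  refine hk (probabilityMeasure_ext fun f => ?_)
  simpa [monomial] using hF _ ⟨1, fun _ => k, fun _ => f, rfl⟩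

omit [CompactSpace M] [MeasurableSpace M] [BorelSpace M] in
theorem tensors_separate (n : ℕ) (x y : Fin n → M) (h : x ≠ y) :
    ∃ F ∈ tensors M n, F x ≠ F y := by
  classical
  obtain ⟨k, hk⟩ := Function.ne_iff.1 h
  refine ⟨_, ⟨Function.update 1 k ⟨fun z => dist z (y k), by fun_prop⟩, rfl⟩, ?_⟩
  have key (z : Fin n → M) : tensor (Function.update (1 : Fin n → C(M, ℝ)) k
      ⟨fun z => dist z (y k), by fun_prop⟩) z = dist (z k) (y k) := by
    simp only [tensor, ContinuousMap.coe_mk]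
    rw [Finset.prod_eq_single k] <;> simp +contextual [Function.update_of_ne]
  rw [key, key]
  simpa using hk

/-- The empirical measure of `k + 1` points. -/
noncomputable def empirical {k : ℕ} (y : Fin (k + 1) → M) : ProbabilityMeasure M :=
  ⟨((k + 1 : ℕ) : ENNReal)⁻¹ • ∑ a, Measure.dirac (y a), ⟨by
    simp [ENNReal.inv_mul_cancel]⟩⟩

theorem integral_empirical {k : ℕ} (y : Fin (k + 1) → M) (f : C(M, ℝ)) :
    ∫ z, f z ∂(empirical y : Measure M) = ((k + 1 : ℕ) : ℝ)⁻¹ * ∑ a, f (y a) := by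
  simp only [empirical, ProbabilityMeasure.coe_mk]
  rw [integral_smul_measure, integral_finsetSum_measure]
  · simp only [integral_dirac, ENNReal.toReal_inv, ENNReal.toReal_natCast, smul_eq_mul]
  · exact fun _ _ => integrable_continuousMap _ f

/-- The tuple of empirical measures of `n` consecutive blocks of `k + 1` points. -/
noncomputable def empiricalTuple (n k : ℕ) (y : Fin (n * (k + 1)) → M) :
    Fin n → ProbabilityMeasure M :=
  fun i => empirical fun a => y (finProdFinEquiv (i, a))

theorem continuous_empiricalTuple (n k : ℕ) :
    Continuous (empiricalTuple (M := M) n k) := by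
  refine continuous_pi fun i => ?_
  refine ProbabilityMeasure.continuous_iff_forall_continuousMap_continuous_integral.2 fun f => ?_
  simp only [empiricalTuple, integral_empirical]
  fun_prop

theorem monomial_empiricalTuple {n N : ℕ} (k : ℕ) (i : Fin N → Fin n) (f : Fin N → C(M, ℝ))
    (y : Fin (n * (k + 1)) → M) :
    monomial i f (empiricalTuple n k y) = (((k + 1 : ℕ) : ℝ) ^ N)⁻¹ *
      ∑ a : Fin N → Fin (k + 1), ∏ j, f j (y (finProdFinEquiv (i j, a j))) := by
  simp only [monomial, ContinuousMap.coe_mk, empiricalTuple, integral_empirical,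
    Finset.prod_mul_distrib, Finset.prod_const, Finset.card_univ, Fintype.card_fin, inv_pow,
    Fintype.prod_sum]

/-- An average over all maps `Fin N → Fin K` is determined by the injective ones, up to an error
proportional to the fraction of the others. -/
theorem abs_average_sub_le {N K : ℕ} (hK : 0 < K) (t : (Fin N → Fin K) → ℝ) (L B : ℝ)
    (hinj : ∀ a, Function.Injective a → t a = L) (ht : ∀ a, |t a| ≤ B) (hL : |L| ≤ B) :
    |((K : ℝ) ^ N)⁻¹ * ∑ a, t a - L| ≤ (1 - (K.descFactorial N : ℝ) / (K : ℝ) ^ N) * (2 * B) := by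
  classical
  have hKN : (0 : ℝ) < (K : ℝ) ^ N := by positivity
  have hcard : ((Finset.univ.filter fun a : Fin N → Fin K => ¬ Function.Injective a).card : ℝ)
      = (K : ℝ) ^ N - K.descFactorial N := by
    have h1 := Finset.card_filter_add_card_filter_not (s := (Finset.univ : Finset (Fin N → Fin K)))
      (fun a => Function.Injective a)
    have h2 : (Finset.univ.filter fun a : Fin N → Fin K => Function.Injective a).card
        = K.descFactorial N := by
      rw [← Fintype.card_subtype,
        Fintype.card_congr (Equiv.subtypeInjectiveEquivEmbedding (Fin N) (Fin K)),
        Fintype.card_embedding_eq, Fintype.card_fin, Fintype.card_fin]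
    rw [h2] at h1
    have h3 : (Finset.univ : Finset (Fin N → Fin K)).card = K ^ N := by simp
    rw [h3] at h1
    rw [eq_sub_iff_add_eq, add_comm]
    exact_mod_cast h1
  have hsum : |∑ a, (t a - L)| ≤ ((K : ℝ) ^ N - K.descFactorial N) * (2 * B) := by
    rw [← Finset.sum_filter_add_sum_filter_not Finset.univ
      (fun a : Fin N → Fin K => Function.Injective a),
      Finset.sum_eq_zero (fun a ha => by rw [hinj a (Finset.mem_filter.1 ha).2, sub_self]),
      zero_add, ← hcard, ← nsmul_eq_mul]
    refine (Finset.abs_sum_le_sum_abs _ _).trans (Finset.sum_le_card_nsmul _ _ _ fun a _ => ?_)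
    exact (abs_sub _ _).trans (by linarith [ht a])
  have heq : ((K : ℝ) ^ N)⁻¹ * ∑ a, t a - L = ((K : ℝ) ^ N)⁻¹ * ∑ a, (t a - L) := by
    rw [Finset.sum_sub_distrib]
    simp
    field_simp
  rw [heq, abs_mul, abs_of_pos (inv_pos.2 hKN)]
  calc _ ≤ ((K : ℝ) ^ N)⁻¹ * (((K : ℝ) ^ N - K.descFactorial N) * (2 * B)) := by gcongr
    _ = _ := by field_simp

theorem tendsto_descFactorial_div_pow (N : ℕ) :
    Tendsto (fun k : ℕ => ((k + 1).descFactorial N : ℝ) / ((k + 1 : ℕ) : ℝ) ^ N) atTop (𝓝 1) := by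
  have h := isEquivalent_descFactorial N
  rw [Asymptotics.isEquivalent_iff_tendsto_one] at h
  · exact (tendsto_add_atTop_iff_nat 1).2 h
  · filter_upwards [eventually_gt_atTop 0] with k hk
    positivity

variable {M₁ : Type} (Pk : (n : ℕ) → (Fin n → M₁) → ProbabilityMeasure (Fin n → M))

/-- `x` together with `ν` satisfies the moment equations of the mixing measure. -/
def HasMoments {n : ℕ} (x : Fin n → M₁)
    (ν : ProbabilityMeasure (Fin n → ProbabilityMeasure M)) : Prop :=
  ∀ (N : ℕ) (i : Fin N → Fin n) (f : Fin N → C(M, ℝ)),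
    ∫ μs, monomial i f μs ∂(ν : Measure (Fin n → ProbabilityMeasure M))
      = ∫ y, tensor f y ∂(Pk N (fun j => x (i j)) : Measure (Fin N → M))

variable {Pk}

theorem exists_hasMoments
    (hPcompat : ∀ (n m : ℕ) (x : Fin n → M₁) (ι : Fin m → Fin n), Function.Injective ι →
      ∀ f : (Fin m → M) → ℝ, Continuous f →
        ∫ y, f (fun j => y (ι j)) ∂(Pk n x : Measure (Fin n → M))
          = ∫ z, f z ∂(Pk m (fun j => x (ι j)) : Measure (Fin m → M)))
    {n : ℕ} (x : Fin n → M₁) : ∃ ν, HasMoments Pk x ν := by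
  let P (k : ℕ) : ProbabilityMeasure (Fin (n * (k + 1)) → M) :=
    Pk (n * (k + 1)) fun t => x (finProdFinEquiv.symm t).1
  let Q (k : ℕ) : ProbabilityMeasure (Fin n → ProbabilityMeasure M) :=
    (P k).map (continuous_empiricalTuple n k).measurable.aemeasurable
  let 𝓤 : Ultrafilter ℕ := Ultrafilter.of atTop
  obtain ⟨ν, -, hν⟩ := isCompact_univ.ultrafilter_le_nhds (𝓤.map Q) (by simp)
  refine ⟨ν, fun N i f => ?_⟩
  set L := ∫ y, tensor f y ∂(Pk N (fun j => x (i j)) : Measure (Fin N → M)) with hL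
  have h1 : Tendsto (fun k => ∫ μs, monomial i f μs ∂(Q k : Measure _)) 𝓤
      (𝓝 (∫ μs, monomial i f μs ∂(ν : Measure _))) :=
    ((ProbabilityMeasure.continuous_integral_continuousMap (monomial i f)).tendsto ν).comp hν
  refine tendsto_nhds_unique h1 (Tendsto.mono_left ?_ (Ultrafilter.of_le atTop))
  have hB (N' : ℕ) (μ : ProbabilityMeasure (Fin N' → M)) (σ : Fin N → Fin N') :
      |∫ y, ∏ j, f j (y (σ j)) ∂(μ : Measure (Fin N' → M))| ≤ ∏ j, ‖f j‖ := by
    have := norm_integral_le_of_norm_le_const (μ := (μ : Measure (Fin N' → M)))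
      (f := fun y => ∏ j, f j (y (σ j))) (C := ∏ j, ‖f j‖) (Eventually.of_forall fun y => by
        rw [norm_prod]
        exact Finset.prod_le_prod (fun _ _ => norm_nonneg _) fun j _ => (f j).norm_coe_le_norm _)
    simpa using this
  have hQ (k : ℕ) : ∫ μs, monomial i f μs ∂(Q k : Measure _) = (((k + 1 : ℕ) : ℝ) ^ N)⁻¹ *
      ∑ a : Fin N → Fin (k + 1), ∫ y, ∏ j, f j (y (finProdFinEquiv (i j, a j)))
        ∂(P k : Measure (Fin (n * (k + 1)) → M)) := by
    simp only [Q, ProbabilityMeasure.toMeasure_map]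
    rw [integral_map (continuous_empiricalTuple n k).measurable.aemeasurable
      (monomial i f).continuous.aestronglyMeasurable]
    simp only [monomial_empiricalTuple]
    rw [integral_const_mul, integral_finsetSum]
    intro a _
    exact integrable_continuousMap _
      (⟨fun y => ∏ j, f j (y (finProdFinEquiv (i j, a j))), by fun_prop⟩ :
        C(Fin (n * (k + 1)) → M, ℝ))
  have hbound (k : ℕ) : |∫ μs, monomial i f μs ∂(Q k : Measure _) - L| ≤
      (1 - ((k + 1).descFactorial N : ℝ) / ((k + 1 : ℕ) : ℝ) ^ N) * (2 * ∏ j, ‖f j‖) := by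
    rw [hQ]
    refine abs_average_sub_le k.succ_pos _ L _ (fun a ha => ?_) (fun a => hB _ _ _) (hB _ _ id)
    have := hPcompat (n * (k + 1)) N (fun t => x (finProdFinEquiv.symm t).1)
      (fun j => finProdFinEquiv (i j, a j))
      (fun j j' h => ha (congrArg Prod.snd (finProdFinEquiv.injective h))) (tensor f)
      (tensor f).continuous
    simp only [Equiv.symm_apply_apply] at this
    exact this
  rw [tendsto_iff_dist_tendsto_zero]
  refine squeeze_zero (fun _ => dist_nonneg) hbound ?_
  simpa using ((tendsto_descFactorial_div_pow N).const_sub 1).mul_const (2 * ∏ j, ‖f j‖)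

section properties

variable (ν : (n : ℕ) → (Fin n → M₁) → ProbabilityMeasure (Fin n → ProbabilityMeasure M))
  (hν : ∀ (n : ℕ) (x : Fin n → M₁), HasMoments Pk x (ν n x))

include hν in
theorem continuous_integral_of_hasMoments [TopologicalSpace M₁]
    (hPcont : ∀ (n : ℕ) (f : (Fin n → M) → ℝ), Continuous f →
      Continuous fun x : Fin n → M₁ => ∫ y, f y ∂(Pk n x : Measure (Fin n → M)))
    (n : ℕ) (F : C(Fin n → ProbabilityMeasure M, ℝ)) :
    Continuous fun x : Fin n → M₁ =>
      ∫ μs, F μs ∂(ν n x : Measure (Fin n → ProbabilityMeasure M)) := by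
  induction F using continuousMap_induction (monomials M n) (monomials_separate n) with
  | hclosed =>
    refine isClosed_of_closure_subset fun F hF => ?_
    refine continuous_of_uniform_approx_of_continuous fun u hu => ?_
    obtain ⟨ε, hε, hu⟩ := Metric.mem_uniformity_dist.1 hu
    obtain ⟨G, hG, hFG⟩ := Metric.mem_closure_iff.1 hF ε hε
    refine ⟨_, hG, fun x => hu ?_⟩
    rw [dist_eq_norm] at hFG
    exact (abs_integral_sub_le _ F G).trans_lt hFG
  | hadd F G hF hG =>
    simp only [ContinuousMap.add_apply,
      integral_add (integrable_continuousMap _ F) (integrable_continuousMap _ G)]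
    exact hF.add hG
  | hsmul c F hF =>
    simp only [ContinuousMap.smul_apply, integral_smul]
    exact hF.const_smul c
  | hmem F hF =>
    obtain ⟨N, i, f, rfl⟩ := hF
    simp only [hν n _ N i f]
    exact (hPcont N _ (tensor f).continuous).comp (by fun_prop)

include hν in
theorem integral_comp_of_hasMoments {n m : ℕ} (x : Fin n → M₁) (ι : Fin m → Fin n)
    (F : C(Fin m → ProbabilityMeasure M, ℝ)) :
    ∫ μs, F (fun j => μs (ι j)) ∂(ν n x : Measure (Fin n → ProbabilityMeasure M))
      = ∫ μs, F μs ∂(ν m (fun j => x (ι j)) : Measure (Fin m → ProbabilityMeasure M)) := by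
  let r : C(Fin n → ProbabilityMeasure M, Fin m → ProbabilityMeasure M) :=
    ⟨fun μs j => μs (ι j), by fun_prop⟩
  change ∫ μs, F.comp r μs ∂(ν n x : Measure (Fin n → ProbabilityMeasure M)) = _
  induction F using continuousMap_induction (monomials M m) (monomials_separate m) with
  | hclosed =>
    exact isClosed_eq ((continuous_integral_left _).comp (ContinuousMap.continuous_precomp r))
      (continuous_integral_left _)
  | hadd F G hF hG =>
    simp only [ContinuousMap.add_comp, ContinuousMap.add_apply]
    rw [integral_add (integrable_continuousMap _ F) (integrable_continuousMap _ G),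
      integral_add (integrable_continuousMap _ _) (integrable_continuousMap _ _), hF, hG]
  | hsmul c F hF =>
    simp only [ContinuousMap.smul_comp, ContinuousMap.smul_apply, integral_smul, hF]
  | hmem F hF =>
    obtain ⟨N, i, f, rfl⟩ := hF
    rw [hν m _ N i f]
    exact hν n x N (fun j => ι (i j)) f

include hν in
theorem ae_eq_of_hasMoments (x : M₁) :
    ∀ᵐ μs ∂(ν 2 (fun _ => x) : Measure (Fin 2 → ProbabilityMeasure M)), μs 0 = μs 1 := by
  have hf (f : C(M, ℝ)) : ∀ᵐ μs ∂(ν 2 (fun _ => x) : Measure (Fin 2 → ProbabilityMeasure M)),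
      ∫ y, f y ∂(μs 0 : Measure M) = ∫ y, f y ∂(μs 1 : Measure M) := by
    let m (a b : Fin 2) : C(Fin 2 → ProbabilityMeasure M, ℝ) := monomial ![a, b] fun _ => f
    have hm (a b : Fin 2) (μs : Fin 2 → ProbabilityMeasure M) :
        m a b μs = (∫ y, f y ∂(μs a : Measure M)) * ∫ y, f y ∂(μs b : Measure M) := by
      simp [m, monomial, Fin.prod_univ_two]
    have hint (a b : Fin 2) := hν 2 (fun _ => x) 2 ![a, b] fun _ => f
    let G : C(Fin 2 → ProbabilityMeasure M, ℝ) := m 0 0 - (2 : ℝ) • m 0 1 + m 1 1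
    have hG (μs : Fin 2 → ProbabilityMeasure M) :
        G μs = (∫ y, f y ∂(μs 0 : Measure M) - ∫ y, f y ∂(μs 1 : Measure M)) ^ 2 := by
      simp only [G, ContinuousMap.add_apply, ContinuousMap.sub_apply, ContinuousMap.smul_apply, hm,
        smul_eq_mul]
      ring
    have hzero : ∫ μs, G μs ∂(ν 2 (fun _ => x) : Measure (Fin 2 → ProbabilityMeasure M)) = 0 := by
      have h1 := integrable_continuousMap
        (ν 2 (fun _ => x) : Measure (Fin 2 → ProbabilityMeasure M))
      have h2 := integral_add (h1 (m 0 0 - (2 : ℝ) • m 0 1)) (h1 (m 1 1))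
      have h3 := integral_sub (h1 (m 0 0)) (h1 ((2 : ℝ) • m 0 1))
      have h4 := integral_smul (μ := (ν 2 (fun _ => x) : Measure (Fin 2 → ProbabilityMeasure M)))
        (2 : ℝ) (m 0 1)
      refine h2.trans ((congrArg (· + _) (h3.trans (congrArg (_ - ·) h4))).trans ?_)
      simp only [m, hint, smul_eq_mul]
      ring
    rw [integral_eq_zero_iff_of_nonneg (fun μs => by simp only [hG]; positivity)
      (integrable_continuousMap _ G)] at hzero
    filter_upwards [hzero] with μs hμs
    rw [hG] at hμs
    exact sub_eq_zero.1 (pow_eq_zero_iff two_ne_zero |>.1 hμs)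
  filter_upwards [ae_all_iff.2 fun k => hf (TopologicalSpace.denseSeq C(M, ℝ) k)] with μs hμs
  refine probabilityMeasure_ext fun f => ?_
  exact congrFun ((TopologicalSpace.denseRange_denseSeq C(M, ℝ)).equalizer
    (continuous_integral_left (μs 0 : Measure M)) (continuous_integral_left (μs 1 : Measure M))
    (funext hμs)) f

omit [CompactSpace M] [BorelSpace M] in
theorem integral_tensor_pi {n : ℕ} (f : Fin n → C(M, ℝ)) (μs : Fin n → ProbabilityMeasure M) :
    ∫ y, tensor f y ∂(Measure.pi fun i => (μs i : Measure M)) =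
      ∏ j, ∫ y, f j y ∂(μs j : Measure M) :=
  integral_fintype_prod_eq_prod fun j => f j

/-- The function `μ ↦ ∫ f d(μ 0 ⊗ ⋯ ⊗ μ (n - 1))`. -/
noncomputable def integralPi {n : ℕ} (f : C(Fin n → M, ℝ)) :
    C(Fin n → ProbabilityMeasure M, ℝ) where
  toFun μs := ∫ y, f y ∂(Measure.pi fun i => (μs i : Measure M))
  continuous_toFun :=
    (ProbabilityMeasure.continuous_integral_continuousMap f).comp ProbabilityMeasure.continuous_pi

theorem continuous_integralPi (n : ℕ) : Continuous (integralPi (M := M) (n := n)) :=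
  (LipschitzWith.of_dist_le_mul (K := 1) fun f g => by
    rw [NNReal.coe_one, one_mul, ContinuousMap.dist_le dist_nonneg]
    intro μs
    rw [dist_eq_norm f g]
    exact abs_integral_sub_le _ f g).continuous

include hν in
theorem integral_eq_integral_integralPi {n : ℕ} (x : Fin n → M₁) (f : C(Fin n → M, ℝ)) :
    ∫ y, f y ∂(Pk n x : Measure (Fin n → M))
      = ∫ μs, integralPi f μs ∂(ν n x : Measure (Fin n → ProbabilityMeasure M)) := by
  induction f using continuousMap_induction (tensors M n) (tensors_separate n) with
  | hclosed =>
    exact isClosed_eq (continuous_integral_left _)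
      ((continuous_integral_left _).comp (continuous_integralPi n))
  | hadd f g hf hg =>
    have : integralPi (f + g) = integralPi f + integralPi g := by
      ext μs
      exact integral_add (integrable_continuousMap _ f) (integrable_continuousMap _ g)
    simp only [this, ContinuousMap.add_apply]
    rw [integral_add (integrable_continuousMap _ f) (integrable_continuousMap _ g),
      integral_add (integrable_continuousMap _ _) (integrable_continuousMap _ _), hf, hg]
  | hsmul c f hf =>
    have : integralPi (c • f) = c • integralPi f := by
      ext μs
      exact integral_smul c f
    simp only [this, ContinuousMap.smul_apply, integral_smul, hf]
  | hmem f hf =>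
    obtain ⟨f, rfl⟩ := hf
    refine (hν n x n id f).symm.trans (integral_congr_ae (Eventually.of_forall fun μs => ?_))
    exact (integral_tensor_pi f μs).symm

end properties

end MultikernelDeFinetti

/-- Theorem 8.8, a de Finetti-type theorem for multikernels.
Let `ℳ₁, ℳ₂` be nonempty compact metric spaces. A multikernel from `ℳ₁` to `ℳ₂` is a
compatible sequence of (weakly) continuous maps `Pₙ : ℳ₁ⁿ → 𝒫(ℳ₂ⁿ)`; it is single-valued
if `∫ dist(y₁,y₂) dP₂(x,x) = 0` for all `x`, where `𝒫(ℳ₂)` carries the Lévy–Prokhorov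
metric. For every multikernel `(Pₙ)` from `ℳ₁` to `ℳ₂` there is a single-valued
multikernel `(νₙ)` from `ℳ₁` to `𝒫(ℳ₂)` such that
`∫ f dPₙ(x₁,…,xₙ) = ∫ (∫ f d(μ₁ ⊗ ⋯ ⊗ μₙ)) dνₙ(x₁,…,xₙ)` for every continuous `f`. -/
theorem statement4
    {M₁ : Type} [MetricSpace M₁] [CompactSpace M₁] [Nonempty M₁]
    {M₂ : Type} [MetricSpace M₂] [CompactSpace M₂] [Nonempty M₂]
    [MeasurableSpace M₂] [BorelSpace M₂]
    (Pk : (n : ℕ) → (Fin n → M₁) → ProbabilityMeasure (Fin n → M₂))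
    (hPcont : ∀ (n : ℕ) (f : (Fin n → M₂) → ℝ), Continuous f →
      Continuous fun x : Fin n → M₁ => ∫ y, f y ∂(Pk n x : Measure (Fin n → M₂)))
    (hPcompat : ∀ (n m : ℕ) (x : Fin n → M₁) (ι : Fin m → Fin n), Function.Injective ι →
      ∀ f : (Fin m → M₂) → ℝ, Continuous f →
        ∫ y, f (fun j => y (ι j)) ∂(Pk n x : Measure (Fin n → M₂))
          = ∫ z, f z ∂(Pk m (fun j => x (ι j)) : Measure (Fin m → M₂))) :
    ∃ ν : (n : ℕ) → (Fin n → M₁) → ProbabilityMeasure (Fin n → ProbabilityMeasure M₂),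
      (∀ (n : ℕ) (F : (Fin n → ProbabilityMeasure M₂) → ℝ), Continuous F →
          (∃ C : ℝ, ∀ μs, |F μs| ≤ C) →
        Continuous fun x : Fin n → M₁ =>
          ∫ μs, F μs ∂(ν n x : Measure (Fin n → ProbabilityMeasure M₂))) ∧
      (∀ (n m : ℕ) (x : Fin n → M₁) (ι : Fin m → Fin n), Function.Injective ι →
        ∀ F : (Fin m → ProbabilityMeasure M₂) → ℝ, Continuous F →
          (∃ C : ℝ, ∀ μs, |F μs| ≤ C) →
          ∫ μs, F (fun j => μs (ι j)) ∂(ν n x : Measure (Fin n → ProbabilityMeasure M₂))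
            = ∫ μs, F μs ∂(ν m (fun j => x (ι j)) :
                Measure (Fin m → ProbabilityMeasure M₂))) ∧
      (∀ x : M₁,
        ∫ μs, levyProkhorovDist (μs 0 : Measure M₂) (μs 1 : Measure M₂)
          ∂(ν 2 (fun _ => x) : Measure (Fin 2 → ProbabilityMeasure M₂)) = 0) ∧
      (∀ (n : ℕ) (x : Fin n → M₁) (f : (Fin n → M₂) → ℝ), Continuous f →
        ∫ y, f y ∂(Pk n x : Measure (Fin n → M₂))
          = ∫ μs, (∫ y, f y ∂(Measure.pi fun i => (μs i : Measure M₂)))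
              ∂(ν n x : Measure (Fin n → ProbabilityMeasure M₂))) := by
  choose ν hν using fun (n : ℕ) (x : Fin n → M₁) =>
    MultikernelDeFinetti.exists_hasMoments hPcompat x
  refine ⟨ν, fun n F hF _ => ?_, fun n m x ι _ F hF _ => ?_, fun x => ?_, fun n x f hf => ?_⟩
  · exact MultikernelDeFinetti.continuous_integral_of_hasMoments ν hν hPcont n ⟨F, hF⟩
  · exact MultikernelDeFinetti.integral_comp_of_hasMoments ν hν x ι ⟨F, hF⟩
  · refine integral_eq_zero_of_ae ?_
    filter_upwards [MultikernelDeFinetti.ae_eq_of_hasMoments ν hν x] with μs hμs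
    simp [hμs, levyProkhorovDist_self]
  · exact MultikernelDeFinetti.integral_eq_integral_integralPi ν hν x ⟨f, hf⟩
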